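/- Let 1 < p < ∞. If a weight w on ℝ belongs to A_p^d, then there is a constant C > 0 such that for all I ∈ D, (1/|I|) Σ_{J∈D, J⊆I} |J| |Δ_J w|² ⟨w^{-1/(p-1)}⟩_J^{p-1} ≤ C ⟨w⟩_I. -/

import Mathlib

open MeasureTheory

noncomputable section

/-- A dyadic interval `[2^{-j} k, 2^{-j}(k+1))`, encoded by its scale `j` and position `k`. -/
structure DyadicInterval where
  j : ℤ
  k : ℤ

namespace DyadicInterval

instance : Countable DyadicInterval :=
  Countable.of_equiv (ℤ × ℤ)
    ⟨fun p => ⟨p.1, p.2⟩, fun I => (I.j, I.k), fun _ => rfl, fun _ => rfl⟩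

/-- The underlying set of a dyadic interval. -/
def toSet (I : DyadicInterval) : Set ℝ :=
  Set.Ico ((2 : ℝ) ^ (-I.j) * (I.k : ℝ)) ((2 : ℝ) ^ (-I.j) * ((I.k : ℝ) + 1))

/-- The length `|I| = 2^{-j}`. -/
def len (I : DyadicInterval) : ℝ := (2 : ℝ) ^ (-I.j)

/-- The left half `I₋` of a dyadic interval. -/
def left (I : DyadicInterval) : DyadicInterval := ⟨I.j + 1, 2 * I.k⟩

/-- The right half `I₊` of a dyadic interval. -/
def right (I : DyadicInterval) : DyadicInterval := ⟨I.j + 1, 2 * I.k + 1⟩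

/-- The integral average `⟨f⟩_I = (1/|I|) ∫_I f`. -/
def avg (I : DyadicInterval) (f : ℝ → ℝ) : ℝ := I.len⁻¹ * ∫ x in I.toSet, f x

/-- `Δ_I f := ⟨f⟩_{I₊} - ⟨f⟩_{I₋}`. -/
def delta (I : DyadicInterval) (f : ℝ → ℝ) : ℝ := avg I.right f - avg I.left f

/-- The Haar function `h_I = |I|^{-1/2} (1_{I₊} - 1_{I₋})`. -/
def haar (I : DyadicInterval) (x : ℝ) : ℝ :=
  (Real.sqrt I.len)⁻¹ *
    (I.right.toSet.indicator (fun _ => (1 : ℝ)) x - I.left.toSet.indicator (fun _ => (1 : ℝ)) x)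

end DyadicInterval

open DyadicInterval

/-- The (unweighted) pairing `⟨f, g⟩ = ∫_ℝ f g`. -/
def ip (f g : ℝ → ℝ) : ℝ := ∫ x, f x * g x

/-- A weight: a.e. positive and locally integrable function on `ℝ`. -/
def IsWeight (w : ℝ → ℝ) : Prop :=
  (∀ᵐ x ∂(volume : Measure ℝ), 0 < w x) ∧ LocallyIntegrable w

/-- A choice of signs `σ = {σ_I}_{I ∈ D}`, `σ_I = ±1`. -/
def IsSigns (σ : DyadicInterval → ℝ) : Prop := ∀ I, σ I = 1 ∨ σ I = -1

/-- The `t`-Haar multiplier `T^t_{w,σ} f = Σ_I σ_I (w/⟨w⟩_I)^t ⟨f,h_I⟩ h_I`. -/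
def tHaar (w : ℝ → ℝ) (t : ℝ) (σ : DyadicInterval → ℝ) (f : ℝ → ℝ) (x : ℝ) : ℝ :=
  ∑' I : DyadicInterval, σ I * (w x / avg I w) ^ t * ip f (haar I) * haar I x

/-- The constant Haar multiplier `(T_σ T_{w,t}) f = Σ_I (σ_I/⟨w⟩_I^t) ⟨f,h_I⟩ h_I`. -/
def constHaar (w : ℝ → ℝ) (t : ℝ) (σ : DyadicInterval → ℝ) (f : ℝ → ℝ) (x : ℝ) : ℝ :=
  ∑' I : DyadicInterval, σ I / (avg I w) ^ t * ip f (haar I) * haar I x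

/-- The operator `T` maps `L²(u)` into `L²(v)` with norm at most `C`. -/
def BddBy (u v : ℝ → ℝ) (T : (ℝ → ℝ) → ℝ → ℝ) (C : ℝ) : Prop :=
  ∀ f : ℝ → ℝ, Measurable f →
    (∫⁻ x, ENNReal.ofReal ((T f x) ^ 2 * v x)) ≤
      ENNReal.ofReal (C ^ 2) * ∫⁻ x, ENNReal.ofReal ((f x) ^ 2 * u x)

/-- The weight `v w^{2t}`. -/
def vw2t (v w : ℝ → ℝ) (t : ℝ) : ℝ → ℝ := fun x => v x * w x ^ (2 * t)

/-- The coefficient `λ_I = (|Δ_I (v w^{2t})|/⟨v w^{2t}⟩_I)(|Δ_I u⁻¹|/⟨u⁻¹⟩_I)(|I|/⟨w⟩_I^t)`. -/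
def posOpCoef (u v w : ℝ → ℝ) (t : ℝ) (I : DyadicInterval) : ℝ :=
  (|delta I (vw2t v w t)| / avg I (vw2t v w t)) * (|delta I (u⁻¹)| / avg I (u⁻¹)) *
    (I.len / (avg I w) ^ t)

/-- The positive operator `P^t_{w,λ} f = Σ_I (w^t/|I|) λ_I ⟨f⟩_I 1_I`. -/
def posOp (u v w : ℝ → ℝ) (t : ℝ) (f : ℝ → ℝ) (x : ℝ) : ℝ :=
  ∑' I : DyadicInterval, (w x ^ t / I.len) * posOpCoef u v w t I * avg I f *
    I.toSet.indicator (fun _ => (1 : ℝ)) x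

/-- Condition (i): `⟨u⁻¹⟩_I ⟨v w^{2t}⟩_I / ⟨w⟩_I^{2t} ≤ C` for all dyadic `I`. -/
def Cond1 (u v w : ℝ → ℝ) (t C : ℝ) : Prop :=
  ∀ I : DyadicInterval, avg I (u⁻¹) * avg I (vw2t v w t) / (avg I w) ^ (2 * t) ≤ C

/-- Condition (ii): the Carleson condition
`(1/|I|) Σ_{J ⊆ I} |J| |Δ_J u⁻¹|² ⟨v w^{2t}⟩_J / ⟨w⟩_J^{2t} ≤ C ⟨u⁻¹⟩_I`,
phrased via finite partial sums. -/
def Cond2 (u v w : ℝ → ℝ) (t C : ℝ) : Prop :=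
  ∀ I : DyadicInterval, ∀ F : Finset DyadicInterval, (∀ J ∈ F, J.toSet ⊆ I.toSet) →
    I.len⁻¹ * ∑ J ∈ F, J.len * (delta J (u⁻¹)) ^ 2 * avg J (vw2t v w t) / (avg J w) ^ (2 * t)
      ≤ C * avg I (u⁻¹)

/-- Condition (iii): the dual Carleson condition
`(1/|I|) Σ_{J ⊆ I} |J| |Δ_J (v w^{2t})|² ⟨u⁻¹⟩_J / ⟨w⟩_J^{2t} ≤ C ⟨v w^{2t}⟩_I`. -/
def Cond3 (u v w : ℝ → ℝ) (t C : ℝ) : Prop :=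
  ∀ I : DyadicInterval, ∀ F : Finset DyadicInterval, (∀ J ∈ F, J.toSet ⊆ I.toSet) →
    I.len⁻¹ * ∑ J ∈ F, J.len * (delta J (vw2t v w t)) ^ 2 * avg J (u⁻¹) / (avg J w) ^ (2 * t)
      ≤ C * avg I (vw2t v w t)

/-- Uniform (in the signs `σ`) boundedness of the `t`-Haar multipliers from `L²(u)` to `L²(v)`. -/
def UnifBdd (u v w : ℝ → ℝ) (t C : ℝ) : Prop :=
  ∀ σ : DyadicInterval → ℝ, IsSigns σ → BddBy u v (tHaar w t σ) C

/-- `{α_I}` is a `v`-Carleson sequence with intensity `B`: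
`Σ_{J ⊆ I} α_J ≤ B v(I)` for all dyadic `I`, via finite partial sums. -/
def CarlesonSeq (v : ℝ → ℝ) (α : DyadicInterval → ℝ) (B : ℝ) : Prop :=
  ∀ I : DyadicInterval, ∀ F : Finset DyadicInterval, (∀ J ∈ F, J.toSet ⊆ I.toSet) →
    ∑ J ∈ F, α J ≤ B * ∫ x in I.toSet, v x

/-- Dyadic reverse Hölder class `RH_p^d`: `sup_I ⟨w⟩_I^{-1} ⟨w^p⟩_I^{1/p} < ∞`. -/
def MemRHp (w : ℝ → ℝ) (p : ℝ) : Prop :=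
  ∃ C : ℝ, ∀ I : DyadicInterval, (avg I (fun x => w x ^ p)) ^ (1 / p) ≤ C * avg I w

/-- Dyadic Muckenhoupt class `A_p^d`: `sup_I ⟨w⟩_I ⟨w^{-1/(p-1)}⟩_I^{p-1} < ∞`. -/
def MemApd (w : ℝ → ℝ) (p : ℝ) : Prop :=
  ∃ C : ℝ, ∀ I : DyadicInterval,
    avg I w * (avg I (fun x => w x ^ (-1 / (p - 1)))) ^ (p - 1) ≤ C

/-- `RH_1^d` condition with constant `B`: `⟨(v/⟨v⟩_I) log(v/⟨v⟩_I)⟩_I ≤ B` for all dyadic `I`. -/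
def RH1Const (v : ℝ → ℝ) (B : ℝ) : Prop :=
  ∀ I : DyadicInterval,
    avg I (fun x => (v x / avg I v) * Real.log (v x / avg I v)) ≤ B

/-- Dyadic class `RH_1^d`. -/
def MemRH1 (v : ℝ → ℝ) : Prop := ∃ B : ℝ, RH1Const v B

/-- The weighted average `⟨g⟩_I^u = (1/u(I)) ∫_I g u`. -/
def wavg (u : ℝ → ℝ) (I : DyadicInterval) (g : ℝ → ℝ) : ℝ :=
  (∫ x in I.toSet, g x * u x) / ∫ x in I.toSet, u x

/-- The weighted Haar function
`h_I^v = v(I)^{-1/2} ( √(v(I₋)/v(I₊)) 1_{I₊} - √(v(I₊)/v(I₋)) 1_{I₋} )`. -/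
def whaar (v : ℝ → ℝ) (I : DyadicInterval) (x : ℝ) : ℝ :=
  (Real.sqrt (∫ y in I.toSet, v y))⁻¹ *
    (Real.sqrt ((∫ y in I.left.toSet, v y) / ∫ y in I.right.toSet, v y) *
        I.right.toSet.indicator (fun _ => (1 : ℝ)) x -
      Real.sqrt ((∫ y in I.right.toSet, v y) / ∫ y in I.left.toSet, v y) *
        I.left.toSet.indicator (fun _ => (1 : ℝ)) x)

/-- The value at averages `x` of `w` and `Y = y ^ (p - 1)` of the convex function driving the
Bellman argument. -/
def bellman (x Y : ℝ) : ℝ := x⁻¹ * (Y⁻¹) ^ 2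

lemma bellman_nonneg {x : ℝ} (hx : 0 ≤ x) (Y : ℝ) : 0 ≤ bellman x Y := by
  unfold bellman; positivity

lemma bellman_convex_gain {x₁ x₂ Y₁ Y₂ Y K : ℝ} (hx₁ : 0 < x₁) (hx₂ : 0 < x₂)
    (hY₁ : 0 < Y₁) (hY₂ : 0 < Y₂) (hY : 0 < Y) (hYY : Y₁ * Y₂ ≤ Y ^ 2)
    (hK : (x₁ + x₂) / 2 * Y ≤ K) :
    (x₂ - x₁) ^ 2 * Y ≤
      8 * K ^ 3 * ((bellman x₁ Y₁ + bellman x₂ Y₂) / 2 - bellman ((x₁ + x₂) / 2) Y) := by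
  obtain ⟨r₁, hr₁, rfl⟩ : ∃ r, 0 < r ∧ x₁ = r ^ 2 :=
    ⟨√x₁, Real.sqrt_pos.2 hx₁, (Real.sq_sqrt hx₁.le).symm⟩
  obtain ⟨r₂, hr₂, rfl⟩ : ∃ r, 0 < r ∧ x₂ = r ^ 2 :=
    ⟨√x₂, Real.sqrt_pos.2 hx₂, (Real.sq_sqrt hx₂.le).symm⟩
  set x := (r₁ ^ 2 + r₂ ^ 2) / 2 with hx
  have hx0 : 0 < x := by positivity
  have hgm : r₁ * r₂ ≤ x := by nlinarith [sq_nonneg (r₁ - r₂)]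
  have hmean : (r₁ * r₂)⁻¹ * (Y⁻¹) ^ 2 ≤ (bellman (r₁ ^ 2) Y₁ + bellman (r₂ ^ 2) Y₂) / 2 := by
    calc (r₁ * r₂)⁻¹ * (Y⁻¹) ^ 2 = (r₁ * r₂)⁻¹ * (Y ^ 2)⁻¹ := by rw [inv_pow]
      _ ≤ (r₁ * r₂)⁻¹ * (Y₁ * Y₂)⁻¹ := by gcongr
      _ = (r₁⁻¹ * Y₁⁻¹) * (r₂⁻¹ * Y₂⁻¹) := by rw [mul_inv, mul_inv]; ring
      _ ≤ ((r₁⁻¹ * Y₁⁻¹) ^ 2 + (r₂⁻¹ * Y₂⁻¹) ^ 2) / 2 := by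
        nlinarith [sq_nonneg (r₁⁻¹ * Y₁⁻¹ - r₂⁻¹ * Y₂⁻¹)]
      _ = _ := by unfold bellman; rw [mul_pow, mul_pow, inv_pow r₁, inv_pow r₂]
  have hgain : (r₂ ^ 2 - r₁ ^ 2) ^ 2 / (8 * x ^ 3) ≤ (r₁ * r₂)⁻¹ - x⁻¹ := by
    set q := r₁ * r₂ with hq
    have hq0 : 0 < q := by positivity
    have h1 : (r₂ ^ 2 - r₁ ^ 2) ^ 2 = 4 * (x - q) * (x + q) := by rw [hx, hq]; ring
    have h2 : q⁻¹ - x⁻¹ = (x - q) / (q * x) := by field_simp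
    rw [h1, h2, div_le_div_iff₀ (by positivity) (by positivity)]
    have h3 : (x + q) * q ≤ 2 * x * x := by nlinarith
    have h4 : 0 ≤ 4 * (x - q) * x := by
      have := sub_nonneg.2 hgm
      positivity
    nlinarith [mul_le_mul_of_nonneg_left h3 h4]
  have hxY : (x * Y) ^ 3 ≤ K ^ 3 := pow_le_pow_left₀ (by positivity) hK 3
  calc (r₂ ^ 2 - r₁ ^ 2) ^ 2 * Y
      = 8 * (x * Y) ^ 3 * ((r₂ ^ 2 - r₁ ^ 2) ^ 2 / (8 * x ^ 3) * (Y⁻¹) ^ 2) := by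
        field_simp
    _ ≤ 8 * K ^ 3 * ((r₂ ^ 2 - r₁ ^ 2) ^ 2 / (8 * x ^ 3) * (Y⁻¹) ^ 2) := by gcongr
    _ ≤ 8 * K ^ 3 * (((r₁ * r₂)⁻¹ - x⁻¹) * (Y⁻¹) ^ 2) := by
        have : 0 ≤ K ^ 3 := le_trans (by positivity) hxY
        gcongr
    _ ≤ _ := by
        have : 0 ≤ K ^ 3 := le_trans (by positivity) hxY
        have h5 : ((r₁ * r₂)⁻¹ - x⁻¹) * (Y⁻¹) ^ 2 ≤
            (bellman (r₁ ^ 2) Y₁ + bellman (r₂ ^ 2) Y₂) / 2 - bellman x Y := by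
          have : bellman x Y = x⁻¹ * (Y⁻¹) ^ 2 := rfl
          rw [this]; linarith
        gcongr

namespace DyadicInterval

lemma len_pos (I : DyadicInterval) : 0 < I.len := by unfold len; positivity

lemma len_left (I : DyadicInterval) : I.left.len = I.len / 2 := by
  simp only [len, left, neg_add, zpow_add₀ (two_ne_zero' ℝ), zpow_neg_one]; ring

lemma len_right (I : DyadicInterval) : I.right.len = I.len / 2 := I.len_left

lemma toSet_eq (I : DyadicInterval) :
    I.toSet = Set.Ico (I.len * I.k) (I.len * (I.k + 1)) := rfl

lemma toSet_left (I : DyadicInterval) :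
    I.left.toSet = Set.Ico (I.len * I.k) (I.len * (I.k + 1 / 2)) := by
  rw [toSet_eq, len_left]; simp only [left]; push_cast; congr 1 <;> ring

lemma toSet_right (I : DyadicInterval) :
    I.right.toSet = Set.Ico (I.len * (I.k + 1 / 2)) (I.len * (I.k + 1)) := by
  rw [toSet_eq, len_right]; simp only [right]; push_cast; congr 1 <;> ring

lemma toSet_left_union_right (I : DyadicInterval) :
    I.left.toSet ∪ I.right.toSet = I.toSet := by
  have := I.len_pos
  rw [toSet_left, toSet_right, toSet_eq, Set.Ico_union_Ico_eq_Ico] <;> nlinarith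

lemma disjoint_left_right (I : DyadicInterval) : Disjoint I.left.toSet I.right.toSet := by
  rw [toSet_left, toSet_right, Set.Ico_disjoint_Ico]
  exact (min_le_left _ _).trans (le_max_right _ _)

lemma measurableSet_toSet (I : DyadicInterval) : MeasurableSet I.toSet := measurableSet_Ico

lemma volume_real_toSet (I : DyadicInterval) : volume.real I.toSet = I.len := by
  have := I.len_pos
  rw [toSet_eq, Real.volume_real_Ico_of_le (by nlinarith)]; ring

lemma avg_eq_half_add (I : DyadicInterval) {f : ℝ → ℝ} (hf : IntegrableOn f I.toSet) :
    avg I f = (avg I.left f + avg I.right f) / 2 := by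
  have hU := I.toSet_left_union_right
  rw [← hU] at hf
  have := I.len_pos
  unfold avg
  rw [len_left, len_right, ← hU, setIntegral_union I.disjoint_left_right
    I.right.measurableSet_toSet hf.left_of_union hf.right_of_union]
  field_simp

lemma toSet_subset_iff (J I : DyadicInterval) :
    J.toSet ⊆ I.toSet ↔ I.len * I.k ≤ J.len * J.k ∧
      J.len * (J.k + 1) ≤ I.len * (I.k + 1) := by
  have := J.len_pos
  rw [toSet_eq, toSet_eq, Set.Ico_subset_Ico_iff (by nlinarith)]

lemma scale_le_of_subset {J I : DyadicInterval} (h : J.toSet ⊆ I.toSet) : I.j ≤ J.j := by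
  obtain ⟨h1, h2⟩ := (toSet_subset_iff J I).1 h
  have h3 : J.len ≤ I.len := by linarith
  unfold len at h3
  rw [zpow_le_zpow_iff_right₀ (by norm_num)] at h3
  linarith

lemma eq_or_subset_half {J I : DyadicInterval} (h : J.toSet ⊆ I.toSet) :
    J = I ∨ J.toSet ⊆ I.left.toSet ∨ J.toSet ⊆ I.right.toSet := by
  have hj := scale_le_of_subset h
  obtain ⟨h1, h2⟩ := (toSet_subset_iff J I).1 h
  rcases hj.eq_or_lt with hj | hj
  · left
    have hl : I.len = J.len := by unfold len; rw [hj]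
    have hp := J.len_pos
    rw [hl] at h1 h2
    have h1' : I.k ≤ J.k := by exact_mod_cast le_of_mul_le_mul_left h1 hp
    have h2' : J.k + 1 ≤ I.k + 1 := by exact_mod_cast le_of_mul_le_mul_left h2 hp
    cases I; cases J
    simp only [mk.injEq] at *
    omega
  · right
    obtain ⟨n, hn⟩ := Int.eq_ofNat_of_zero_le (a := J.j - (I.j + 1)) (by omega)
    have hl : I.len = J.len * (2 * 2 ^ n) := by
      have : -I.j = -J.j + (1 + (n : ℤ)) := by omega
      unfold len
      rw [this, zpow_add₀ two_ne_zero, zpow_add₀ two_ne_zero, zpow_one, zpow_natCast]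
    have hp := J.len_pos
    rw [toSet_subset_iff, toSet_subset_iff, len_left, len_right]
    simp only [left, right]
    push_cast
    rcases le_or_gt (J.k + 1) (2 ^ n * (2 * I.k + 1)) with hk | hk
    · left
      have hk' : (J.k : ℝ) + 1 ≤ 2 ^ n * (2 * I.k + 1) := by exact_mod_cast hk
      refine ⟨by linarith, ?_⟩
      rw [hl]
      linarith [mul_le_mul_of_nonneg_left hk' hp.le]
    · right
      have hk' : (2 : ℝ) ^ n * (2 * I.k + 1) ≤ J.k := by exact_mod_cast Int.lt_add_one_iff.1 hk
      refine ⟨?_, by linarith⟩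
      rw [hl]
      linarith [mul_le_mul_of_nonneg_left hk' hp.le]

/-- A nonnegative quantity controlled at each dyadic interval by the concavity defect of a
nonnegative function `B` satisfies the corresponding packing estimate. -/
lemma sum_le_of_concavity_defect {T B : DyadicInterval → ℝ} (hT : ∀ I, 0 ≤ T I)
    (hB : ∀ I, 0 ≤ B I) (hstep : ∀ I, T I + B (left I) + B (right I) ≤ B I)
    (I : DyadicInterval) (F : Finset DyadicInterval) (hF : ∀ J ∈ F, J.toSet ⊆ I.toSet) :
    ∑ J ∈ F, T J ≤ B I := by
  classical
  obtain ⟨n, hn⟩ : ∃ n : ℕ, ∀ J ∈ F, J.j < I.j + n := by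
    refine ⟨F.sup (fun J => (J.j - I.j).toNat) + 1, fun J hJ => ?_⟩
    have := Finset.le_sup (f := fun J : DyadicInterval => (J.j - I.j).toNat) hJ
    push_cast
    have h' : (J.j - I.j).toNat ≤ F.sup (fun J => (J.j - I.j).toNat) := this
    omega
  induction n generalizing I F with
  | zero =>
    have : F = ∅ := Finset.eq_empty_of_forall_notMem fun J hJ => by
      have h1 := hn J hJ
      have h2 := scale_le_of_subset (hF J hJ)
      simp at h1; omega
    simpa [this] using hB I
  | succ n ih =>
    have hl := ih I.left (F.filter fun J => J.toSet ⊆ I.left.toSet)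
      (fun J hJ => (Finset.mem_filter.1 hJ).2)
      (fun J hJ => by
        have := hn J (Finset.mem_filter.1 hJ).1
        simp only [left]; push_cast at this; omega)
    have hr := ih I.right (F.filter fun J => J.toSet ⊆ I.right.toSet)
      (fun J hJ => (Finset.mem_filter.1 hJ).2)
      (fun J hJ => by
        have := hn J (Finset.mem_filter.1 hJ).1
        simp only [right]; push_cast at this; omega)
    have hI : ∑ J ∈ F with J = I, T J ≤ T I := by
      rw [Finset.sum_filter, Finset.sum_ite_eq']
      split_ifs
      · exact le_rfl
      · exact hT I
    have hsplit : ∑ J ∈ F, T J ≤ (∑ J ∈ F with J = I, T J) +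
        (∑ J ∈ F with J.toSet ⊆ I.left.toSet, T J) +
        ∑ J ∈ F with J.toSet ⊆ I.right.toSet, T J := by
      rw [Finset.sum_filter, Finset.sum_filter, Finset.sum_filter, ← Finset.sum_add_distrib,
        ← Finset.sum_add_distrib]
      refine Finset.sum_le_sum fun J hJ => ?_
      have hTJ := hT J
      rcases eq_or_subset_half (hF J hJ) with h | h | h <;> simp only [h, if_true] <;>
        split_ifs <;> first | linarith | (subst h; linarith)
    linarith [hstep I]

lemma avg_nonneg (I : DyadicInterval) {f : ℝ → ℝ} (hf : ∀ᵐ x, 0 ≤ f x) : 0 ≤ avg I f :=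
  mul_nonneg (inv_nonneg.2 I.len_pos.le)
    (integral_nonneg_of_ae (ae_restrict_of_ae hf))

end DyadicInterval

lemma IsWeight.integrableOn {w : ℝ → ℝ} (hw : IsWeight w) (I : DyadicInterval) :
    IntegrableOn w I.toSet :=
  (hw.2.integrableOn_isCompact isCompact_Icc).mono_set Set.Ico_subset_Icc_self

lemma IsWeight.avg_pos {w : ℝ → ℝ} (hw : IsWeight w) (I : DyadicInterval) : 0 < avg I w := by
  refine mul_pos (inv_pos.2 I.len_pos) ?_
  have hpos : ∀ᵐ x ∂volume.restrict I.toSet, 0 < w x := ae_restrict_of_ae hw.1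
  rw [integral_pos_iff_support_of_nonneg_ae (hpos.mono fun _ h => h.le) (hw.integrableOn I)]
  have huniv : (Function.support w : Set ℝ) =ᵐ[volume.restrict I.toSet] Set.univ := by
    filter_upwards [hpos] with x hx
    exact propext ⟨fun _ => trivial, fun _ => hx.ne'⟩
  rw [measure_congr huniv, Measure.restrict_apply_univ, pos_iff_ne_zero]
  intro h0
  have := I.volume_real_toSet
  rw [measureReal_def, h0] at this
  exact I.len_pos.ne this

/-- Jensen's inequality for the negative power `z ↦ z ^ (-r)` on dyadic intervals. -/
lemma IsWeight.rpow_neg_avg_le {w : ℝ → ℝ} (hw : IsWeight w) {r : ℝ} (hr : 0 ≤ r)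
    (I : DyadicInterval) (hI : IntegrableOn (fun x => w x ^ (-r)) I.toSet) :
    avg I w ^ (-r) ≤ avg I (fun x => w x ^ (-r)) := by
  have hx := hw.avg_pos I
  set a := avg I w with ha
  have hlen := I.len_pos
  have hpt : ∀ᵐ z ∂volume.restrict I.toSet,
      a ^ (-r) * (1 + r) - a ^ (-r) * (r * a⁻¹) * w z ≤ w z ^ (-r) := by
    filter_upwards [ae_restrict_of_ae hw.1] with z hz
    have hq : 0 < w z / a := div_pos hz hx
    have h1 : 1 - r * (w z / a - 1) ≤ (w z / a) ^ (-r) := by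
      rw [Real.rpow_def_of_pos hq]
      have h2 := Real.log_le_sub_one_of_pos hq
      have h3 := Real.add_one_le_exp (Real.log (w z / a) * -r)
      nlinarith [mul_le_mul_of_nonneg_left h2 hr]
    calc a ^ (-r) * (1 + r) - a ^ (-r) * (r * a⁻¹) * w z
        = a ^ (-r) * (1 - r * (w z / a - 1)) := by ring
      _ ≤ a ^ (-r) * (w z / a) ^ (-r) := by gcongr
      _ = w z ^ (-r) := by
        rw [← Real.mul_rpow hx.le hq.le, mul_div_cancel₀ _ hx.ne']
  have hfin : volume I.toSet ≠ ⊤ := measure_Ico_lt_top.ne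
  have hc : IntegrableOn (fun _ : ℝ => a ^ (-r) * (1 + r)) I.toSet := integrableOn_const hfin
  have hlin := (hw.integrableOn I).const_mul (a ^ (-r) * (r * a⁻¹))
  have hmono := integral_mono_ae (hc.sub hlin) hI hpt
  have hint : ∫ z in I.toSet, w z = I.len * a := by
    rw [ha, avg]; field_simp
  rw [integral_sub' hc hlin, setIntegral_const, integral_const_mul, hint,
    I.volume_real_toSet, smul_eq_mul] at hmono
  unfold avg
  rw [le_inv_mul_iff₀ hlen]
  refine le_trans (le_of_eq ?_) hmono
  field_simp
  ring

/-- If `w ∈ A_p^d` (`1 < p < ∞`) then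
`(1/|I|) Σ_{J ⊆ I} |J| |Δ_J w|² ⟨w^{-1/(p-1)}⟩_J^{p-1} ≤ C ⟨w⟩_I` for all dyadic `I`. -/
theorem Apd_dual_summation (p : ℝ) (hp : 1 < p) (w : ℝ → ℝ) (hw : IsWeight w)
    (hAp : MemApd w p) :
    ∃ C > 0, ∀ I : DyadicInterval, ∀ F : Finset DyadicInterval,
      (∀ J ∈ F, J.toSet ⊆ I.toSet) →
      I.len⁻¹ *
          ∑ J ∈ F, J.len * (delta J w) ^ 2 * (avg J (fun x => w x ^ (-1 / (p - 1)))) ^ (p - 1)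
        ≤ C * avg I w := by
  obtain ⟨C₀, hC₀⟩ := hAp
  set m := p - 1 with hm
  have hm0 : 0 < m := by linarith
  set s : ℝ → ℝ := fun x => w x ^ (-1 / m) with hs
  have hs' : s = fun x => w x ^ (-(1 / m)) := by rw [hs]; simp only [neg_div]
  set K := max C₀ 1 with hK
  have hK0 : 0 < K := lt_of_lt_of_le one_pos (le_max_right _ _)
  have hApK (I : DyadicInterval) : avg I w * avg I s ^ m ≤ K := (hC₀ I).trans (le_max_left _ _)
  have hw0 (I : DyadicInterval) : 0 < avg I w := hw.avg_pos I
  have hs0 (I : DyadicInterval) : 0 ≤ avg I s :=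
    avg_nonneg I (hw.1.mono fun x hx => (Real.rpow_pos_of_pos hx _).le)
  have hsm0 (I : DyadicInterval) : 0 ≤ avg I s ^ m := Real.rpow_nonneg (hs0 I) m
  have hjensen (I : DyadicInterval) (hI : IntegrableOn s I.toSet) :
      avg I w ^ (-(1 / m)) ≤ avg I s := by
    rw [hs'] at hI ⊢
    exact hw.rpow_neg_avg_le (by positivity) I hI
  have hspos (I : DyadicInterval) (hI : IntegrableOn s I.toSet) : 0 < avg I s :=
    (Real.rpow_pos_of_pos (hw0 I) _).trans_le (hjensen I hI)
  have hone (I : DyadicInterval) (hI : IntegrableOn s I.toSet) :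
      1 ≤ avg I w * avg I s ^ m := by
    have h := Real.rpow_le_rpow (Real.rpow_pos_of_pos (hw0 I) _).le (hjensen I hI) hm0.le
    rw [← Real.rpow_mul (hw0 I).le, neg_mul, one_div_mul_cancel hm0.ne', Real.rpow_neg_one] at h
    calc (1 : ℝ) = avg I w * (avg I w)⁻¹ := (mul_inv_cancel₀ (hw0 I).ne').symm
      _ ≤ _ := mul_le_mul_of_nonneg_left h (hw0 I).le
  -- If `s` is not integrable on `I`, then `avg I s = 0` and the corresponding terms vanish.
  have hbad (I : DyadicInterval) (hI : ¬ IntegrableOn s I.toSet) : avg I s ^ m = 0 := by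
    have : avg I s = 0 := by rw [avg, integral_undef hI, mul_zero]
    rw [this, Real.zero_rpow hm0.ne']
  have hwsplit (I : DyadicInterval) := avg_eq_half_add I (hw.integrableOn I)
  set B : DyadicInterval → ℝ := fun I =>
    8 * K ^ 3 * (I.len * (avg I w - bellman (avg I w) (avg I s ^ m))) with hB
  have hsum := sum_le_of_concavity_defect
    (T := fun J => J.len * (delta J w) ^ 2 * avg J s ^ m) (B := B)
    (fun I => by have := hsm0 I; have := I.len_pos; positivity)
    (fun I => by
      have hlen := I.len_pos
      have hle : bellman (avg I w) (avg I s ^ m) ≤ avg I w := by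
        by_cases hI : IntegrableOn s I.toSet
        · have hY : 0 < avg I s ^ m := Real.rpow_pos_of_pos (hspos I hI) m
          have hx := hw0 I
          have h2 : 1 ≤ (avg I w * avg I s ^ m) ^ 2 := one_le_pow₀ (hone I hI)
          unfold bellman
          rw [inv_pow, ← mul_inv]
          refine inv_le_of_inv_le₀ hx ?_
          rw [inv_le_iff_one_le_mul₀ hx]
          linarith
        · rw [hbad I hI]
          simpa [bellman] using (hw0 I).le
      have := sub_nonneg.2 hle
      positivity)
    (fun I => by
      have hlen := I.len_pos
      simp only [hB, len_left, len_right]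
      by_cases hI : IntegrableOn s I.toSet
      · have hU := I.toSet_left_union_right
        have hIl : IntegrableOn s I.left.toSet := (hU ▸ hI).left_of_union
        have hIr : IntegrableOn s I.right.toSet := (hU ▸ hI).right_of_union
        have hyl := hspos _ hIl
        have hyr := hspos _ hIr
        have hYY : avg I.left s ^ m * avg I.right s ^ m ≤ (avg I s ^ m) ^ 2 := by
          rw [sq, ← Real.mul_rpow hyl.le hyr.le, ← Real.mul_rpow (hs0 I) (hs0 I)]
          refine Real.rpow_le_rpow (by positivity) ?_ hm0.le
          rw [avg_eq_half_add I hI]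
          nlinarith [sq_nonneg (avg I.left s - avg I.right s)]
        have hgain := bellman_convex_gain (K := K) (hw0 I.left) (hw0 I.right)
          (Real.rpow_pos_of_pos hyl m) (Real.rpow_pos_of_pos hyr m)
          (Real.rpow_pos_of_pos (hspos I hI) m) hYY (by rw [← hwsplit I]; exact hApK I)
        rw [← hwsplit I] at hgain
        have := mul_le_mul_of_nonneg_left hgain hlen.le
        unfold delta
        have hx2 := congrArg (fun t => 8 * K ^ 3 * (I.len * t)) (hwsplit I)
        linarith
      · rw [hbad I hI]
        have h1 := bellman_nonneg (hw0 I.left).le (avg I.left s ^ m)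
        have h2 := bellman_nonneg (hw0 I.right).le (avg I.right s ^ m)
        have h3 : bellman (avg I w) 0 = 0 := by simp [bellman]
        have h4 : 0 ≤ 8 * K ^ 3 * (I.len / 2 * (bellman (avg I.left w) (avg I.left s ^ m) +
          bellman (avg I.right w) (avg I.right s ^ m))) := by positivity
        rw [h3, hwsplit I]
        linarith)
  refine ⟨8 * K ^ 3, by positivity, fun I F hF => ?_⟩
  rw [inv_mul_le_iff₀ I.len_pos]
  refine (hsum I F hF).trans ?_
  have hlen := I.len_pos
  have h0 : 0 ≤ 8 * K ^ 3 * (I.len * bellman (avg I w) (avg I s ^ m)) := by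
    have := bellman_nonneg (hw0 I).le (avg I s ^ m)
    positivity
  simp only [hB]
  linarith
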